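/- arXiv:1606.07023 — 2 statements merged into one kernel-verified Lean document; each statement's English description precedes it below -/
import Mathlib

section
/- Let A, B, C be the vertices of an acute triangle in the Euclidean plane, and let D, E, F be the feet of the altitudes from A, B, C respectively (so D lies on line BC, E on line CA, F on line AB), forming the orthic triangle DEF. Then the angle of the orthic triangle at E equals π/2 (i.e., ∠DEF = π/2) if and only if ∠ABC = π/4. -/
open EuclideanGeometry Real

section

variable {V : Type*} [NormedAddCommGroup V] [InnerProductSpace ℝ V]

theorem EuclideanGeometry.coe_orthogonalProjection_affineSpan_pair (p q x : V) :
    (EuclideanGeometry.orthogonalProjection (affineSpan ℝ {p, q}) x : V) =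
      p + (inner ℝ (x - p) (q - p) / inner ℝ (q - p) (q - p)) • (q - p) := by
  rw [coe_orthogonalProjection_eq_iff_mem]
  constructor
  · simpa [AffineMap.lineMap_apply, add_comm] using AffineMap.lineMap_mem_affineSpan_pair
      (inner ℝ (x - p) (q - p) / inner ℝ (q - p) (q - p)) p q
  · rw [direction_affineSpan, vectorSpan_pair_rev, Submodule.mem_orthogonal_singleton_iff_inner_left,
      vsub_eq_sub, vsub_eq_sub, ← sub_sub, inner_sub_left, real_inner_smul_left]
    rcases eq_or_ne (q - p) 0 with h | h
    · simp [h]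
    · rw [div_mul_cancel₀ _ (inner_self_ne_zero.mpr h), sub_self]

theorem InnerProductGeometry.inner_pos_of_angle_lt_pi_div_two {u v : V}
    (h : InnerProductGeometry.angle u v < π / 2) : 0 < inner ℝ u v := by
  have hu : u ≠ 0 := by
    rintro rfl
    simp at h
  have hv : v ≠ 0 := by
    rintro rfl
    simp at h
  rw [← InnerProductGeometry.cos_angle_mul_norm_mul_norm]
  have hcos := cos_pos_of_mem_Ioo
    ⟨by linarith [InnerProductGeometry.angle_nonneg u v, pi_pos], h⟩
  positivity

theorem InnerProductGeometry.angle_eq_pi_div_four_iff {u v : V} (h : 0 < inner ℝ u v) :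
    InnerProductGeometry.angle u v = π / 4 ↔
      2 * inner ℝ u v ^ 2 = inner ℝ u u * inner ℝ v v := by
  have hu : 0 < ‖u‖ := norm_pos_iff.mpr fun h₀ => by simp [h₀] at h
  have hv : 0 < ‖v‖ := norm_pos_iff.mpr fun h₀ => by simp [h₀] at h
  rw [← InnerProductGeometry.cos_angle_mul_norm_mul_norm] at h ⊢
  have hcos : 0 < cos (InnerProductGeometry.angle u v) := pos_of_mul_pos_left h (by positivity)
  rw [real_inner_self_eq_norm_sq, real_inner_self_eq_norm_sq]
  have hsq : cos (π / 4) ^ 2 = 1 / 2 := by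
    rw [cos_pi_div_four, div_pow, sq_sqrt zero_le_two]
    norm_num
  have hpos : 0 < cos (π / 4) := by
    rw [cos_pi_div_four]
    positivity
  have hinj : InnerProductGeometry.angle u v = π / 4 ↔
      cos (InnerProductGeometry.angle u v) = cos (π / 4) :=
    (injOn_cos.eq_iff ⟨InnerProductGeometry.angle_nonneg u v, InnerProductGeometry.angle_le_pi u v⟩
      ⟨by positivity, by linarith [pi_pos]⟩).symm
  rw [hinj, ← sq_eq_sq₀ hcos.le hpos.le, hsq]
  have hne : ‖u‖ ^ 2 * ‖v‖ ^ 2 ≠ 0 := by positivity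
  constructor
  · intro h'
    linear_combination 2 * ‖u‖ ^ 2 * ‖v‖ ^ 2 * h'
  · intro h'
    apply mul_right_cancel₀ hne
    linear_combination h' / 2

/-- With vertices `A = u`, `B = 0`, `C = v`, the inner product of the sides at `E` of the
orthic triangle `DEF`. -/
theorem inner_orthic_sides (u v : V) (hu : inner ℝ u u ≠ 0) (hv : inner ℝ v v ≠ 0)
    (huv : inner ℝ (u - v) (u - v) ≠ 0) :
    inner ℝ
      ((inner ℝ u v / inner ℝ v v) • v -
        (v + (inner ℝ (-v) (u - v) / inner ℝ (u - v) (u - v)) • (u - v)))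
      (u + (inner ℝ (v - u) (-u) / inner ℝ u u) • (-u) -
        (v + (inner ℝ (-v) (u - v) / inner ℝ (u - v) (u - v)) • (u - v))) =
    inner ℝ (-v) (u - v) * inner ℝ (v - u) (-u) *
        (inner ℝ u u * inner ℝ v v - 2 * inner ℝ u v ^ 2) /
      (inner ℝ (u - v) (u - v) * inner ℝ u u * inner ℝ v v) := by
  simp only [inner_sub_left, inner_sub_right, inner_add_left, inner_add_right, inner_neg_left,
    inner_neg_right, real_inner_smul_left, real_inner_smul_right, real_inner_comm u v] at huv ⊢
  generalize inner ℝ u u = p at *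
  generalize inner ℝ v v = q at *
  generalize inner ℝ u v = r at *
  field_simp
  ring

end

theorem orthic_angle_right_iff_angle_pi_div_four
    (A B C D E F : EuclideanSpace ℝ (Fin 2))
    (hABC : AffineIndependent ℝ ![A, B, C])
    (hA : ∠ B A C < π / 2) (hB : ∠ A B C < π / 2) (hC : ∠ B C A < π / 2)
    (hD : D = (EuclideanGeometry.orthogonalProjection (affineSpan ℝ {B, C}) A :
      EuclideanSpace ℝ (Fin 2)))
    (hE : E = (EuclideanGeometry.orthogonalProjection (affineSpan ℝ {C, A}) B :
      EuclideanSpace ℝ (Fin 2)))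
    (hF : F = (EuclideanGeometry.orthogonalProjection (affineSpan ℝ {A, B}) C :
      EuclideanSpace ℝ (Fin 2))) :
    ∠ D E F = π / 2 ↔ ∠ A B C = π / 4 := by
  obtain ⟨u, rfl⟩ : ∃ u, A = B + u := ⟨A - B, by abel⟩
  obtain ⟨v, rfl⟩ : ∃ v, C = B + v := ⟨C - B, by abel⟩
  rw [coe_orthogonalProjection_affineSpan_pair] at hD hE hF
  simp only [add_sub_cancel_left, add_sub_add_left_eq_sub, sub_add_cancel_left] at hD hE hF
  simp only [EuclideanGeometry.angle, vsub_eq_sub, add_sub_cancel_left, add_sub_add_left_eq_sub,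
    sub_add_cancel_left] at hA hB hC ⊢
  replace hA := InnerProductGeometry.inner_pos_of_angle_lt_pi_div_two hA
  replace hB := InnerProductGeometry.inner_pos_of_angle_lt_pi_div_two hB
  replace hC := InnerProductGeometry.inner_pos_of_angle_lt_pi_div_two hC
  rw [real_inner_comm] at hA
  have hu : inner ℝ u u ≠ 0 := inner_self_ne_zero.mpr fun h => by simp [h] at hB
  have hv : inner ℝ v v ≠ 0 := inner_self_ne_zero.mpr fun h => by simp [h] at hB
  have huv : inner ℝ (u - v) (u - v) ≠ 0 := inner_self_ne_zero.mpr fun h => by simp [h] at hC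
  have hDE : D - E = (inner ℝ u v / inner ℝ v v) • v -
      (v + (inner ℝ (-v) (u - v) / inner ℝ (u - v) (u - v)) • (u - v)) := by
    rw [hD, hE]
    abel
  have hFE : F - E = u + (inner ℝ (v - u) (-u) / inner ℝ u u) • (-u) -
      (v + (inner ℝ (-v) (u - v) / inner ℝ (u - v) (u - v)) • (u - v)) := by
    rw [hF, hE, inner_neg_neg]
    abel
  rw [← InnerProductGeometry.inner_eq_zero_iff_angle_eq_pi_div_two, hDE, hFE,
    inner_orthic_sides u v hu hv huv, InnerProductGeometry.angle_eq_pi_div_four_iff hB,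
    div_eq_zero_iff, or_iff_left (mul_ne_zero (mul_ne_zero huv hu) hv), mul_eq_zero,
    or_iff_right (mul_ne_zero hC.ne' hA.ne'), sub_eq_zero, eq_comm]
end

section
/- Let A, B, C be the vertices of an acute triangle in the Euclidean plane, and let D, E, F be the feet of the altitudes from A, B, C respectively. If ∠ABC = π/4, then the angle of the orthic triangle at E is a right angle, i.e., ∠DEF = π/2. -/
open EuclideanGeometry Real

/-- The foot of the perpendicular from `P` to the line `XY`, as a combination of `X` and `Y`. -/
lemma exists_coe_orthogonalProjection_line_eq {V : Type*} [NormedAddCommGroup V]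
    [InnerProductSpace ℝ V] (P X Y : V) :
    ∃ t : ℝ, (EuclideanGeometry.orthogonalProjection (affineSpan ℝ {X, Y}) P : V)
        = X + t • (Y - X) ∧
      inner ℝ (P - (X + t • (Y - X))) (Y - X) = 0 := by
  have hmem := EuclideanGeometry.orthogonalProjection_mem (s := affineSpan ℝ {X, Y}) P
  obtain ⟨t, ht⟩ := mem_affineSpan_pair_iff_exists_lineMap_eq.1 hmem
  have hP : (EuclideanGeometry.orthogonalProjection (affineSpan ℝ {X, Y}) P : V)
      = X + t • (Y - X) := by
    rw [← ht, AffineMap.lineMap_apply, vsub_eq_sub, vadd_eq_add, add_comm]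
  refine ⟨t, hP, ?_⟩
  have hperp := vsub_orthogonalProjection_mem_direction_orthogonal (affineSpan ℝ {X, Y}) P
  rw [hP, vsub_eq_sub] at hperp
  exact (Submodule.mem_orthogonal' _ _).1 hperp _
    (AffineSubspace.vsub_mem_direction (right_mem_affineSpan_pair ℝ X Y)
      (left_mem_affineSpan_pair ℝ X Y))

/-- If `u` and `v` span an angle of `π / 4`, the segments joining the foot of the perpendicular
from the origin onto the line `uv` to the feet of the other two altitudes are perpendicular. -/
lemma inner_orthic_eq_zero_of_angle_eq_pi_div_four {V : Type*} [NormedAddCommGroup V]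
    [InnerProductSpace ℝ V] {u v : V} {d e f : ℝ}
    (huv : InnerProductGeometry.angle u v = π / 4)
    (hd : inner ℝ (u - d • v) v = 0) (he : inner ℝ (v + e • (u - v)) (u - v) = 0)
    (hf : inner ℝ (v - f • u) u = 0) :
    inner ℝ (d • v - (v + e • (u - v))) (f • u - (v + e • (u - v))) = 0 := by
  have hu : u ≠ 0 := by
    rintro rfl
    rw [InnerProductGeometry.angle_zero_left] at huv
    linarith [pi_pos]
  have hv : v ≠ 0 := by
    rintro rfl
    rw [InnerProductGeometry.angle_zero_right] at huv
    linarith [pi_pos]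
  have hp : inner ℝ u u ≠ 0 := inner_self_ne_zero.2 hu
  have hq : inner ℝ v v ≠ 0 := inner_self_ne_zero.2 hv
  have hpq : 2 * inner ℝ u v ^ 2 = inner ℝ u u * inner ℝ v v := by
    rw [← InnerProductGeometry.cos_angle_mul_norm_mul_norm, huv, cos_pi_div_four,
      real_inner_self_eq_norm_sq, real_inner_self_eq_norm_sq]
    have h2 : √2 ^ 2 = 2 := sq_sqrt (by norm_num)
    linear_combination (‖u‖ ^ 2 * ‖v‖ ^ 2 / 2) * h2
  simp only [inner_sub_left, inner_sub_right, inner_add_left, inner_add_right,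
    real_inner_smul_left, real_inner_smul_right, real_inner_comm u v] at *
  generalize (inner ℝ u u : ℝ) = p at *
  generalize (inner ℝ v v : ℝ) = q at *
  generalize (inner ℝ u v : ℝ) = r at *
  have hr : r ≠ 0 := by
    rintro rfl
    exact mul_ne_zero hp hq (by linarith)
  have hdp : 2 * r * d = p := mul_right_cancel₀ hq (by linear_combination hpq - 2 * r * hd)
  have hfq : 2 * r * f = q := mul_left_cancel₀ hp (by linear_combination hpq - 2 * r * hf)
  refine (mul_eq_zero.1 ?_).resolve_left (mul_ne_zero two_ne_zero hr)
  linear_combination (r * f - (q + e * (r - q))) * hdp + (p / 2 - (q + e * (r - q))) * hfq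
    + hpq / 2 + (2 * r * (e - f) - (r - q)) * he

theorem angle_pi_div_four_imp_orthic_angle_right
    (A B C D E F : EuclideanSpace ℝ (Fin 2))
    (hABC : AffineIndependent ℝ ![A, B, C])
    (hA : ∠ B A C < π / 2) (hB : ∠ A B C < π / 2) (hC : ∠ B C A < π / 2)
    (hD : D = (EuclideanGeometry.orthogonalProjection (affineSpan ℝ {B, C}) A :
      EuclideanSpace ℝ (Fin 2)))
    (hE : E = (EuclideanGeometry.orthogonalProjection (affineSpan ℝ {C, A}) B :
      EuclideanSpace ℝ (Fin 2)))
    (hF : F = (EuclideanGeometry.orthogonalProjection (affineSpan ℝ {A, B}) C :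
      EuclideanSpace ℝ (Fin 2))) :
    ∠ A B C = π / 4 → ∠ D E F = π / 2 := by
  intro h
  obtain ⟨d, hd, hd'⟩ := exists_coe_orthogonalProjection_line_eq A B C
  obtain ⟨e, he, he'⟩ := exists_coe_orthogonalProjection_line_eq B C A
  obtain ⟨f, hf, hf'⟩ := exists_coe_orthogonalProjection_line_eq C A B
  rw [hd] at hD
  rw [he] at hE
  rw [hf] at hF
  have key := inner_orthic_eq_zero_of_angle_eq_pi_div_four (u := A - B) (v := C - B)
    (d := d) (e := e) (f := 1 - f) h
    (by rw [← hd']; congr 1; module)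
    (by rw [← neg_eq_zero, ← inner_neg_left, ← he']; congr 1 <;> module)
    (by rw [← neg_eq_zero, ← inner_neg_right, ← hf']; congr 1 <;> module)
  refine InnerProductGeometry.inner_eq_zero_iff_angle_eq_pi_div_two _ _ |>.1 ?_
  rw [← key, hD, hE, hF, vsub_eq_sub, vsub_eq_sub]
  congr 1 <;> module
end
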